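/- Let k be a field, σ : k → k a ring homomorphism, N a k-vector space of finite dimension n, and V : N → N an additive map with V(cx) = σ(c)·V(x) for all c ∈ k, x ∈ N, such that V is nilpotent. A complete flag 0 = E_0 ⊂ E_1 ⊂ ... ⊂ E_n = N is called V-stable if V(E_i) ⊆ E_i for all i. Consider the equivalence relation on V-stable complete flags generated by the operations that, for some 1 ≤ i ≤ n−1 with V(E_{i+1}) ⊆ E_{i−1}, replace E_i by an arbitrary i-dimensional subspace E with E_{i−1} ⊆ E ⊆ E_{i+1}, leaving all other members unchanged. Then any two V-stable complete flags of N are equivalent. -/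

import Mathlib

/-- A complete flag `0 = E₀ ⊂ E₁ ⊂ … ⊂ E_n = N` with `dim E_i = i`. -/
def IsCompleteFlag (k N : Type*) [Field k] [AddCommGroup N] [Module k N] (n : ℕ)
    (E : Fin (n + 1) → Submodule k N) : Prop :=
  E 0 = ⊥ ∧ E (Fin.last n) = ⊤ ∧ (∀ i j : Fin (n + 1), i ≤ j → E i ≤ E j) ∧
    ∀ i : Fin (n + 1), Module.finrank k (E i) = (i : ℕ)

/-- A complete flag stable under the map `f` («`V`-stable»). -/
def IsVStableFlag (k N : Type*) [Field k] [AddCommGroup N] [Module k N] (n : ℕ)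
    (f : N → N) (E : Fin (n + 1) → Submodule k N) : Prop :=
  IsCompleteFlag k N n E ∧ ∀ i : Fin (n + 1), ∀ x ∈ E i, f x ∈ E i

/-- An elementary move between `V`-stable complete flags: for some
`1 ≤ i ≤ n−1` with `V(E_{i+1}) ⊆ E_{i−1}`, replace `E_i` by an arbitrary
`i`-dimensional subspace between `E_{i−1}` and `E_{i+1}`, leaving all other
members unchanged. -/
def VMove (k N : Type*) [Field k] [AddCommGroup N] [Module k N] (n : ℕ)
    (f : N → N) (E F : Fin (n + 1) → Submodule k N) : Prop :=
  IsVStableFlag k N n f E ∧ IsVStableFlag k N n f F ∧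
    ∃ i : ℕ, ∃ _h1 : 1 ≤ i, ∃ _h2 : i < n,
      (∀ x ∈ E ⟨i + 1, by omega⟩, f x ∈ E ⟨i - 1, by omega⟩) ∧
      ∀ j : Fin (n + 1), (j : ℕ) ≠ i → E j = F j

/-- A nilpotent semilinear map that stabilises `A ≤ B`, with `A` of codimension one in `B`,
sends `B` into `A`. -/
theorem map_mem_of_nilpotent_of_finrank_eq_succ {k N : Type*} [Field k] [AddCommGroup N]
    [Module k N] [FiniteDimensional k N] (σ : k →+* k) (f : N → N)
    (hadd : ∀ x y : N, f (x + y) = f x + f y)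
    (hsmul : ∀ (c : k) (x : N), f (c • x) = σ c • f x)
    (hnilp : ∃ m : ℕ, 1 ≤ m ∧ ∀ x : N, f^[m] x = 0)
    {A B : Submodule k N} (hAB : A ≤ B) (hA : ∀ x ∈ A, f x ∈ A) (hB : ∀ x ∈ B, f x ∈ B)
    (hrank : Module.finrank k B = Module.finrank k A + 1) :
    ∀ x ∈ B, f x ∈ A := by
  intro x hx
  by_contra hfx
  have hxA : x ∉ A := fun h => hfx (hA x h)
  have hsup : A ⊔ Submodule.span k {x} = B := by
    have hle : A ⊔ Submodule.span k {x} ≤ B :=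
      sup_le hAB ((Submodule.span_singleton_le_iff_mem x B).2 hx)
    refine Submodule.eq_of_le_of_finrank_le hle ?_
    have hlt : A < A ⊔ Submodule.span k {x} := by
      refine lt_of_le_of_ne le_sup_left fun h => hxA ?_
      rw [h]
      exact Submodule.mem_sup_right (Submodule.mem_span_singleton_self x)
    have := Submodule.finrank_lt_finrank_of_lt hlt
    omega
  have hstep : ∀ y ∈ B, y ∉ A → f y ∉ A := by
    intro y hy hyA hfy
    rw [← hsup] at hy
    obtain ⟨a, ha, z, hz, rfl⟩ := Submodule.mem_sup.1 hy
    obtain ⟨d, rfl⟩ := Submodule.mem_span_singleton.1 hz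
    have hd : d ≠ 0 := by
      rintro rfl
      exact hyA (by simpa using ha)
    rw [hadd, hsmul, Submodule.add_mem_iff_right _ (hA a ha),
      Submodule.smul_mem_iff _ ((map_ne_zero σ).2 hd)] at hfy
    exact hfx hfy
  have hiter : ∀ r : ℕ, f^[r] x ∈ B ∧ f^[r] x ∉ A := by
    intro r
    induction r with
    | zero => exact ⟨hx, hxA⟩
    | succ r ih =>
      rw [Function.iterate_succ_apply']
      exact ⟨hB _ ih.1, hstep _ ih.1 ih.2⟩
  obtain ⟨m, -, hm⟩ := hnilp
  exact (hiter m).2 (hm x ▸ A.zero_mem)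

/-- Intersecting with a hyperplane that does not contain `A` lowers the dimension of `A` by one. -/
theorem finrank_inf_add_one_of_not_le {k N : Type*} [Field k] [AddCommGroup N]
    [Module k N] [FiniteDimensional k N] {A H B : Submodule k N} (hA : A ≤ B) (hH : H ≤ B)
    (hrank : Module.finrank k B = Module.finrank k H + 1) (hAH : ¬ A ≤ H) :
    Module.finrank k (A ⊓ H : Submodule k N) + 1 = Module.finrank k A := by
  have h1 := Submodule.finrank_sup_add_finrank_inf_eq A H
  have h2 := Submodule.finrank_mono (sup_le hA hH)
  have h3 : H < A ⊔ H := lt_of_le_of_ne le_sup_right fun h => hAH (h ▸ le_sup_left)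
  have h4 := Submodule.finrank_lt_finrank_of_lt h3
  omega

open Classical in
/-- The flag `E` with its members below position `m` replaced by the flag that `E` induces on
`E m ⊓ H`, where `H` is a hyperplane of `E (m + 1)`, and with `P` in position `m`. -/
noncomputable def inducedFlag {k N : Type*} [Field k] [AddCommGroup N] [Module k N] {n : ℕ}
    (E : Fin (n + 1) → Submodule k N) (H P : Submodule k N) (m : Fin (n + 1)) :
    Fin (n + 1) → Submodule k N :=
  fun i => if i = m then P else if m < i ∨ E (i + 1) ≤ H then E i else E (i + 1) ⊓ H

theorem inducedFlag_of_lt {k N : Type*} [Field k] [AddCommGroup N] [Module k N] {n : ℕ}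
    (E : Fin (n + 1) → Submodule k N) (H P : Submodule k N) {m i : Fin (n + 1)} (h : m < i) :
    inducedFlag E H P m i = E i := by
  simp [inducedFlag, h, h.ne']

theorem inducedFlag_self {k N : Type*} [Field k] [AddCommGroup N] [Module k N] {n : ℕ}
    (E : Fin (n + 1) → Submodule k N) (H P : Submodule k N) (m : Fin (n + 1)) :
    inducedFlag E H P m m = P := by
  simp [inducedFlag]

theorem inducedFlag_of_gt_of_le {k N : Type*} [Field k] [AddCommGroup N] [Module k N] {n : ℕ}
    (E : Fin (n + 1) → Submodule k N) {H : Submodule k N} (P : Submodule k N)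
    {m i : Fin (n + 1)} (h : i < m) (hi : E (i + 1) ≤ H) :
    inducedFlag E H P m i = E i := by
  simp [inducedFlag, h.ne, hi]

theorem inducedFlag_of_gt_of_not_le {k N : Type*} [Field k] [AddCommGroup N] [Module k N] {n : ℕ}
    (E : Fin (n + 1) → Submodule k N) {H : Submodule k N} (P : Submodule k N)
    {m i : Fin (n + 1)} (h : i < m) (hi : ¬ E (i + 1) ≤ H) :
    inducedFlag E H P m i = E (i + 1) ⊓ H := by
  simp [inducedFlag, h.ne, hi, h.le]

theorem isVStableFlag_inducedFlag {k N : Type*} [Field k] [AddCommGroup N] [Module k N]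
    [FiniteDimensional k N] {n : ℕ} {f : N → N} {E : Fin (n + 1) → Submodule k N}
    (hE : IsVStableFlag k N n f E) {H P : Submodule k N} {m : Fin (n + 1)}
    (hm : m < Fin.last n) (hHE : H ≤ E (m + 1)) (hHm : Module.finrank k H = m)
    (hHf : ∀ x ∈ H, f x ∈ H) (hPE : P ≤ E (m + 1)) (hPm : Module.finrank k P = m)
    (hPf : ∀ x ∈ P, f x ∈ P) (hP : E m ⊓ H ≤ P) :
    IsVStableFlag k N n f (inducedFlag E H P m) := by
  obtain ⟨⟨-, htop, hmono, hdim⟩, hst⟩ := hE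
  have hm1 : ((m + 1 : Fin (n + 1)) : ℕ) = m + 1 := Fin.val_add_one_of_lt hm
  have hsucc : ∀ i, i < m → ((i + 1 : Fin (n + 1)) : ℕ) = i + 1 := fun i hi =>
    Fin.val_add_one_of_lt (hi.trans hm)
  have hfin : ∀ i, Module.finrank k (inducedFlag E H P m i) = (i : ℕ) := by
    intro i
    rcases lt_trichotomy i m with h | rfl | h
    · by_cases hi : E (i + 1) ≤ H
      · rw [inducedFlag_of_gt_of_le E P h hi, hdim]
      · rw [inducedFlag_of_gt_of_not_le E P h hi]
        have hle : E (i + 1) ≤ E (m + 1) := hmono _ _ (by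
          rw [Fin.le_def, hsucc i h, hm1]; exact Nat.succ_le_succ h.le)
        have := finrank_inf_add_one_of_not_le hle hHE (by rw [hdim, hm1, hHm]) hi
        rw [hdim, hsucc i h] at this
        omega
    · rw [inducedFlag_self, hPm]
    · rw [inducedFlag_of_lt E H P h, hdim]
  have hle_inf : ∀ i, i < m → inducedFlag E H P m i ≤ E m ⊓ H := by
    intro i h
    have h1 : E (i + 1) ≤ E m := hmono _ _ (by rw [Fin.le_def, hsucc i h]; exact h)
    have h2 : E i ≤ E (i + 1) := hmono _ _ (by rw [Fin.le_def, hsucc i h]; omega)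
    by_cases hi : E (i + 1) ≤ H
    · rw [inducedFlag_of_gt_of_le E P h hi]
      exact le_inf (h2.trans h1) (h2.trans hi)
    · rw [inducedFlag_of_gt_of_not_le E P h hi]
      exact inf_le_inf_right H h1
  have hP_le : ∀ j, m < j → P ≤ E j := fun j h =>
    hPE.trans (hmono _ _ (by rw [Fin.le_def, hm1]; exact h))
  refine ⟨⟨?_, ?_, ?_, hfin⟩, ?_⟩
  · rw [← Submodule.finrank_eq_zero (R := k), hfin]
    rfl
  · rw [inducedFlag_of_lt E H P hm, htop]
  · intro i j hij
    rcases hij.eq_or_lt with rfl | hij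
    · exact le_rfl
    rcases lt_trichotomy j m with h | rfl | h
    · have hi := hij.trans h
      have h1 : E (i + 1) ≤ E (j + 1) := hmono _ _ (by
        rw [Fin.le_def, hsucc i hi, hsucc j h]; exact Nat.succ_le_succ hij.le)
      have h2 : E i ≤ E (i + 1) := hmono _ _ (by rw [Fin.le_def, hsucc i hi]; omega)
      by_cases hjH : E (j + 1) ≤ H
      · rw [inducedFlag_of_gt_of_le E P h hjH,
          inducedFlag_of_gt_of_le E P hi (h1.trans hjH)]
        exact hmono _ _ hij.le
      · rw [inducedFlag_of_gt_of_not_le E P h hjH]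
        by_cases hiH : E (i + 1) ≤ H
        · rw [inducedFlag_of_gt_of_le E P hi hiH]
          exact le_inf (h2.trans h1) (h2.trans hiH)
        · rw [inducedFlag_of_gt_of_not_le E P hi hiH]
          exact inf_le_inf_right H h1
    · rw [inducedFlag_self]
      exact (hle_inf i hij).trans hP
    · rw [inducedFlag_of_lt E H P h]
      rcases lt_trichotomy i m with hi | rfl | hi
      · exact ((hle_inf i hi).trans hP).trans (hP_le j h)
      · rw [inducedFlag_self]
        exact hP_le j h
      · rw [inducedFlag_of_lt E H P hi]
        exact hmono _ _ hij.le
  · intro i x hx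
    rcases lt_trichotomy i m with h | rfl | h
    · by_cases hi : E (i + 1) ≤ H
      · rw [inducedFlag_of_gt_of_le E P h hi] at hx ⊢
        exact hst _ x hx
      · rw [inducedFlag_of_gt_of_not_le E P h hi] at hx ⊢
        exact ⟨hst _ x hx.1, hHf x hx.2⟩
    · rw [inducedFlag_self] at hx ⊢
      exact hPf x hx
    · rw [inducedFlag_of_lt E H P h] at hx ⊢
      exact hst _ x hx

/-- Two `V`-stable complete flags that agree from position `m` on are equivalent. -/
theorem eqvGen_vMove_of_eq_above {k N : Type*} [Field k] [AddCommGroup N] [Module k N]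
    [FiniteDimensional k N] {n : ℕ} (σ : k →+* k) (f : N → N)
    (hadd : ∀ x y : N, f (x + y) = f x + f y)
    (hsmul : ∀ (c : k) (x : N), f (c • x) = σ c • f x)
    (hnilp : ∃ m : ℕ, 1 ≤ m ∧ ∀ x : N, f^[m] x = 0) (m : ℕ)
    (E F : Fin (n + 1) → Submodule k N)
    (hE : IsVStableFlag k N n f E) (hF : IsVStableFlag k N n f F)
    (hEF : ∀ j : Fin (n + 1), m ≤ j → E j = F j) :
    Relation.EqvGen (VMove k N n f) E F := by
  induction m generalizing E F with
  | zero =>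
    obtain rfl : E = F := funext fun j => hEF j (Nat.zero_le _)
    exact .refl _
  | succ m ih =>
    by_cases hm : ∀ h : m < n + 1, E ⟨m, h⟩ = F ⟨m, h⟩
    · refine ih E F hE hF fun j hj => ?_
      rcases hj.eq_or_lt with h | h
      · subst h
        exact hm j.2
      · exact hEF j h
    push Not at hm
    obtain ⟨hmn, hne⟩ := hm
    have hlt : m < n := by
      refine lt_of_le_of_ne (Nat.le_of_lt_succ hmn) ?_
      rintro rfl
      exact hne (hE.1.2.1.trans hF.1.2.1.symm)
    have hpos : 1 ≤ m := by
      rw [Nat.one_le_iff_ne_zero]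
      rintro rfl
      exact hne (hE.1.1.trans hF.1.1.symm)
    set M : Fin (n + 1) := ⟨m, hmn⟩ with hM
    have hMlast : M < Fin.last n := hlt
    have hM1 : M + 1 = ⟨m + 1, by omega⟩ := Fin.ext (Fin.val_add_one_of_lt hMlast)
    have hMle : M ≤ M + 1 := by rw [hM1, Fin.le_def]; exact Nat.le_succ m
    have hEF1 : E (M + 1) = F (M + 1) := hEF _ (by rw [hM1])
    have hEM : E M ≤ E (M + 1) := hE.1.2.2.1 _ _ hMle
    have hFM : F M ≤ E (M + 1) := hEF1 ▸ hF.1.2.2.1 _ _ hMle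
    have hdim1 : Module.finrank k (E (M + 1)) = m + 1 := by rw [hE.1.2.2.2, hM1]
    have hnle : ¬ E M ≤ F M := fun h => hne
      (Submodule.eq_of_le_of_finrank_eq h (by rw [hE.1.2.2.2, hF.1.2.2.2]))
    have hG : IsVStableFlag k N n f (inducedFlag E (F M) (E M) M) :=
      isVStableFlag_inducedFlag hE hMlast hFM (hF.1.2.2.2 M) (hF.2 M) hEM (hE.1.2.2.2 M)
        (hE.2 M) inf_le_left
    have hG' : IsVStableFlag k N n f (inducedFlag E (F M) (F M) M) :=
      isVStableFlag_inducedFlag hE hMlast hFM (hF.1.2.2.2 M) (hF.2 M) hFM (hF.1.2.2.2 M)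
        (hF.2 M) inf_le_right
    have hmove : VMove k N n f (inducedFlag E (F M) (E M) M) (inducedFlag E (F M) (F M) M) := by
      refine ⟨hG, hG', m, hpos, hlt, fun x hx => ?_, fun j hj => ?_⟩
      · have hlow : (⟨m - 1, by omega⟩ : Fin (n + 1)) < M := by
          rw [Fin.lt_def]; exact Nat.sub_lt hpos Nat.one_pos
        have hup : (⟨m - 1, by omega⟩ : Fin (n + 1)) + 1 = M :=
          Fin.ext ((Fin.val_add_one_of_lt (hlow.trans hMlast)).trans (Nat.sub_add_cancel hpos))
        rw [← hM1, inducedFlag_of_lt E _ _ (by rw [hM1, Fin.lt_def]; exact Nat.lt_succ_self m)]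
          at hx
        rw [inducedFlag_of_gt_of_not_le E _ hlow (by rwa [hup]), hup]
        exact ⟨map_mem_of_nilpotent_of_finrank_eq_succ σ f hadd hsmul hnilp hEM (hE.2 M)
            (hE.2 (M + 1)) (by rw [hdim1, hE.1.2.2.2]) x hx,
          map_mem_of_nilpotent_of_finrank_eq_succ σ f hadd hsmul hnilp hFM (hF.2 M)
            (hE.2 (M + 1)) (by rw [hdim1, hF.1.2.2.2]) x hx⟩
      · have hjM : j ≠ M := fun h => hj (congrArg Fin.val h)
        simp [inducedFlag, hjM]
    have habove : ∀ j : Fin (n + 1), m ≤ j → j = M ∨ M < j := fun j hj =>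
      (Nat.eq_or_lt_of_le hj).imp (fun h => Fin.ext h.symm) id
    refine .trans _ _ _ (ih _ _ hE hG fun j hj => ?_)
      (.trans _ _ _ (.rel _ _ hmove) (ih _ _ hG' hF fun j hj => ?_))
    · rcases habove j hj with rfl | h
      · rw [inducedFlag_self]
      · rw [inducedFlag_of_lt E _ _ h]
    · rcases habove j hj with rfl | h
      · rw [inducedFlag_self]
      · rw [inducedFlag_of_lt E _ _ h]
        exact hEF j h

/-- for a nilpotent `σ`-semilinear map `V` on an
`n`-dimensional vector space `N`, the equivalence relation on `V`-stable
complete flags generated by the elementary moves has exactly one class: any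
two `V`-stable complete flags are equivalent. -/
theorem stmt18 (k N : Type*) [Field k] [AddCommGroup N] [Module k N]
    [FiniteDimensional k N] (n : ℕ) (hn : Module.finrank k N = n)
    (σ : k →+* k) (f : N → N)
    (hadd : ∀ x y : N, f (x + y) = f x + f y)
    (hsmul : ∀ (c : k) (x : N), f (c • x) = σ c • f x)
    (hnilp : ∃ m : ℕ, 1 ≤ m ∧ ∀ x : N, f^[m] x = 0)
    (E F : Fin (n + 1) → Submodule k N)
    (hE : IsVStableFlag k N n f E) (hF : IsVStableFlag k N n f F) :
    Relation.EqvGen (VMove k N n f) E F := by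
  exact eqvGen_vMove_of_eq_above σ f hadd hsmul hnilp (n + 1) E F hE hF
    fun j hj => absurd j.2 (by omega)
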